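/- Let G be a connected compact metric graph with exponents p̄ and nonlinearities γ_e as above, with at least 3 vertices, f = (f_e) with f_e ∈ L^1(0,ℓ_e), and ω : V → ℝ. Let v₁ and v_n be two distinct vertices of degree 1 (each incident to exactly one edge), with v₁ = ι e₁ for an edge e₁ and v_n = τ e₂ for a different edge e₂. For ε ≥ 0, define ω^ε : V → ℝ by ω^ε(v₁) = ω(v₁) − ε, ω^ε(v_n) = ω(v_n) + ε, and ω^ε = ω at all other vertices, and let v_ε = (γ_e ∘ u_{ε,e})_e be the unique weak solution of (P_{ω^ε}^f), with u_ε its continuous representative. Then ε ↦ u_ε(v_n) is continuous and nondecreasing on [0,∞), ε ↦ u_ε(v₁) is continuous and nonincreasing on [0,∞), and at least one of the following holds: u_ε(v_n) → +∞ as ε → +∞, or u_ε(v₁) → −∞ as ε → +∞. -/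

import Mathlib

open MeasureTheory Set Filter

noncomputable section

/-- A connected compact metric graph: finite nonempty vertex set, finite edge set,
initial/terminal vertex maps without loops, positive edge lengths, no multiple edges,
and connectedness via paths of edges. -/
structure MetricGraph where
  V : Type
  E : Type
  fintypeV : Fintype V
  fintypeE : Fintype E
  nonemptyV : Nonempty V
  ι : E → V
  τ : E → V
  no_loops : ∀ e, ι e ≠ τ e
  len : E → ℝ
  len_pos : ∀ e, 0 < len e
  no_multi : ∀ e e', ({ι e, τ e} : Set V) = ({ι e', τ e'} : Set V) → e = e'
  connected : ∀ v w : V,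
    Relation.ReflTransGen (fun a b => ∃ e, (ι e = a ∧ τ e = b) ∨ (ι e = b ∧ τ e = a)) v w

/-- Sum over the edges of the graph. -/
def edgeSum (G : MetricGraph) (F : G.E → ℝ) : ℝ :=
  letI := G.fintypeE
  ∑ e, F e

/-- Sum over the vertices of the graph. -/
def vertexSum (G : MetricGraph) (F : G.V → ℝ) : ℝ :=
  letI := G.fintypeV
  ∑ v, F v

/-- Number of vertices. -/
def vertexCard (G : MetricGraph) : ℕ :=
  letI := G.fintypeV
  Fintype.card G.V

/-- ρ_p(r) = |r|^(p-2) r. -/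
def rho (p r : ℝ) : ℝ := |r| ^ (p - 2) * r

/-- `(u, u')` is in the Sobolev space W^{1,p}(0,ℓ): `u'` is integrable with `|u'|^p`
integrable on (0,ℓ), and `u` is absolutely continuous on [0,ℓ] with derivative `u'`. -/
def IntervalSobolev (ℓ p : ℝ) (u u' : ℝ → ℝ) : Prop :=
  IntegrableOn u' (Ioo 0 ℓ) volume ∧
  IntegrableOn (fun x => |u' x| ^ p) (Ioo 0 ℓ) volume ∧
  ∀ x ∈ Icc (0:ℝ) ℓ, u x = u 0 + ∫ t in (0:ℝ)..x, u' t

/-- `(u, u')` is in W^{1,p̄}(G), continuous at the vertices with vertex values `uV`. -/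
def GraphSobolev (G : MetricGraph) (p : G.E → ℝ) (u u' : G.E → ℝ → ℝ) (uV : G.V → ℝ) : Prop :=
  (∀ e, IntervalSobolev (G.len e) (p e) (u e) (u' e)) ∧
  (∀ e, u e 0 = uV (G.ι e)) ∧
  (∀ e, u e (G.len e) = uV (G.τ e))

/-- `v` is a weak solution of the graph problem (P_ω^f) with data `u, u', uV`. -/
def SolvesGraphProblem (G : MetricGraph) (p : G.E → ℝ) (γ : G.E → ℝ → ℝ)
    (f : G.E → ℝ → ℝ) (ω : G.V → ℝ)
    (v : G.E → ℝ → ℝ) (u u' : G.E → ℝ → ℝ) (uV : G.V → ℝ) : Prop :=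
  (∀ e, IntegrableOn (v e) (Ioo 0 (G.len e)) volume) ∧
  GraphSobolev G p u u' uV ∧
  (∀ e, ∀ᵐ x ∂(volume.restrict (Ioo 0 (G.len e))), v e x = γ e (u e x)) ∧
  ∀ φ φ' : G.E → ℝ → ℝ, ∀ φV : G.V → ℝ, GraphSobolev G p φ φ' φV →
    edgeSum G (fun e => ∫ x in Ioo 0 (G.len e), v e x * φ e x)
      + edgeSum G (fun e => ∫ x in Ioo 0 (G.len e), rho (p e) (u' e x) * φ' e x)
    = edgeSum G (fun e => ∫ x in Ioo 0 (G.len e), f e x * φ e x)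
      + vertexSum G (fun w => ω w * φV w)

/-- `v` is a weak solution of the graph problem (P_ω^f). -/
def IsGraphWeakSolution (G : MetricGraph) (p : G.E → ℝ) (γ : G.E → ℝ → ℝ)
    (f : G.E → ℝ → ℝ) (ω : G.V → ℝ) (v : G.E → ℝ → ℝ) : Prop :=
  ∃ u u' uV, SolvesGraphProblem G p γ f ω v u u' uV

/-- `v` is a weak solution of the interval Neumann problem (P^{γ,f}_{p,a,b}),
with associated Sobolev function `u` (derivative `u'`). -/
def SolvesNeumann (ℓ p : ℝ) (γ f : ℝ → ℝ) (a b : ℝ) (v u u' : ℝ → ℝ) : Prop :=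
  IntegrableOn v (Ioo 0 ℓ) volume ∧
  IntervalSobolev ℓ p u u' ∧
  (∀ᵐ x ∂(volume.restrict (Ioo 0 ℓ)), v x = γ (u x)) ∧
  ∀ φ φ' : ℝ → ℝ, IntervalSobolev ℓ p φ φ' →
    (∫ x in Ioo 0 ℓ, v x * φ x) + (∫ x in Ioo 0 ℓ, rho p (u' x) * φ' x)
    = (∫ x in Ioo 0 ℓ, f x * φ x) + a * φ 0 + b * φ ℓ

/-- `v` is a weak solution of the interval Neumann problem (P^{γ,f}_{p,a,b}). -/
def IsNeumannWeakSolution (ℓ p : ℝ) (γ f : ℝ → ℝ) (a b : ℝ) (v : ℝ → ℝ) : Prop :=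
  ∃ u u', SolvesNeumann ℓ p γ f a b v u u'

end

lemma rho_mul_self {p : ℝ} (hp : 1 < p) (a : ℝ) : rho p a * a = |a| ^ p := by
  rcases eq_or_ne a 0 with rfl | ha
  · simp [Real.zero_rpow (by linarith : p ≠ 0)]
  · rw [rho, mul_assoc, ← abs_mul_abs_self a, ← mul_assoc, ← Real.rpow_add_one (by positivity),
      ← Real.rpow_add_one (by positivity)]
    congr 1
    ring

lemma abs_rho {p : ℝ} (hp : 1 < p) (a : ℝ) : |rho p a| = |a| ^ (p - 1) := by
  rcases eq_or_ne a 0 with rfl | ha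
  · simp [rho, Real.zero_rpow (by linarith : p - 1 ≠ 0)]
  · rw [rho, abs_mul, abs_of_nonneg (by positivity : 0 ≤ |a| ^ (p - 2)),
      ← Real.rpow_add_one (by positivity)]
    congr 1
    ring

lemma rho_of_nonneg {p : ℝ} (hp : 1 < p) {a : ℝ} (ha : 0 ≤ a) : rho p a = a ^ (p - 1) := by
  have h : 0 ≤ rho p a := by unfold rho; positivity
  rw [← abs_of_nonneg h, abs_rho hp, abs_of_nonneg ha]

lemma rho_neg (p a : ℝ) : rho p (-a) = -rho p a := by
  simp [rho]

lemma rho_monotone {p : ℝ} (hp : 1 < p) : Monotone (rho p) := by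
  have key : ∀ a b : ℝ, 0 ≤ a → a ≤ b → rho p a ≤ rho p b := fun a b ha hab => by
    rw [rho_of_nonneg hp ha, rho_of_nonneg hp (ha.trans hab)]
    exact Real.rpow_le_rpow ha hab (by linarith)
  have nonneg : ∀ a : ℝ, 0 ≤ a → 0 ≤ rho p a := fun a ha => by unfold rho; positivity
  intro a b hab
  rcases le_total 0 a with ha | ha
  · exact key a b ha hab
  · have h1 := nonneg (-a) (by linarith)
    rw [rho_neg] at h1
    rcases le_total 0 b with hb | hb
    · linarith [nonneg b hb]
    · have := key (-b) (-a) (by linarith) (by linarith)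
      rw [rho_neg, rho_neg] at this
      linarith

lemma measurable_rho (p : ℝ) : Measurable (rho p) := by
  unfold rho
  fun_prop

lemma Monotone.sub_mul_sub_nonneg {g : ℝ → ℝ} (hg : Monotone g) (a b : ℝ) :
    0 ≤ (g a - g b) * (a - b) := by
  rcases le_total a b with h | h
  · exact mul_nonneg_of_nonpos_of_nonpos (by linarith [hg h]) (by linarith)
  · exact mul_nonneg (by linarith [hg h]) (by linarith)

lemma abs_rpow_sub_one_mul_abs_le {p : ℝ} (hp : 1 < p) (a b : ℝ) :
    |a| ^ (p - 1) * |b| ≤ |a| ^ p + |b| ^ p := by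
  have hm : 0 ≤ max |a| |b| := le_max_of_le_left (abs_nonneg a)
  calc |a| ^ (p - 1) * |b| ≤ max |a| |b| ^ (p - 1) * max |a| |b| := by
        have h1 : |a| ≤ max |a| |b| := le_max_left _ _
        have h2 : |b| ≤ max |a| |b| := le_max_right _ _
        gcongr
    _ = max |a| |b| ^ p := by
        rw [← Real.rpow_add_one' hm (by linarith)]
        congr 1
        ring
    _ ≤ |a| ^ p + |b| ^ p := by
        rcases le_total |a| |b| with h | h
        · rw [max_eq_right h]
          linarith [Real.rpow_nonneg (abs_nonneg a) p]
        · rw [max_eq_left h]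
          linarith [Real.rpow_nonneg (abs_nonneg b) p]

/-- Lower-order powers are absorbed by an arbitrarily small multiple of a higher one. -/
lemma exists_rpow_le_mul_rpow_add {q p : ℝ} (hq : 0 < q) (hqp : q < p) {θ : ℝ} (hθ : 0 < θ) :
    ∃ C, 0 ≤ C ∧ ∀ r : ℝ, 0 ≤ r → r ^ q ≤ θ * r ^ p + C := by
  set R := (1 / θ) ^ (1 / (p - q)) with hR
  have hR0 : 0 ≤ R := by positivity
  have hpq : 0 < p - q := by linarith
  refine ⟨R ^ q, by positivity, fun r hr => ?_⟩
  rcases le_total r R with h | h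
  · have := Real.rpow_le_rpow hr h hq.le
    have : 0 ≤ θ * r ^ p := by positivity
    linarith
  · have h1 : 1 / θ ≤ r ^ (p - q) := by
      have := Real.rpow_le_rpow hR0 h hpq.le
      rwa [hR, ← Real.rpow_mul (by positivity), one_div_mul_cancel hpq.ne', Real.rpow_one] at this
    have h2 : r ^ p = r ^ (p - q) * r ^ q := by
      rw [← Real.rpow_add' hr (by linarith)]
      congr 1
      ring
    have h3 : 1 ≤ θ * r ^ (p - q) := by
      rwa [div_le_iff₀ hθ, mul_comm] at h1
    have h4 : 0 ≤ r ^ q := by positivity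
    have h5 : 0 ≤ R ^ q := by positivity
    rw [h2]
    nlinarith [mul_le_mul_of_nonneg_right h3 h4]

section IntervalSobolev

variable {ℓ p : ℝ} {u u' w w' : ℝ → ℝ}

lemma IntervalSobolev.memLp (hp : 1 < p) (h : IntervalSobolev ℓ p u u') :
    MemLp u' (ENNReal.ofReal p) (volume.restrict (Ioo 0 ℓ)) := by
  have hp0 : ENNReal.ofReal p ≠ 0 := by simp; linarith
  rw [← integrable_norm_rpow_iff h.1.aestronglyMeasurable hp0 ENNReal.ofReal_ne_top,
    ENNReal.toReal_ofReal (by linarith)]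
  exact h.2.1

lemma intervalSobolev_const (hp : 1 < p) (c : ℝ) :
    IntervalSobolev ℓ p (fun _ => c) (fun _ => 0) := by
  refine ⟨by simp, ?_, by simp⟩
  simp [Real.zero_rpow (by linarith : p ≠ 0)]

lemma IntervalSobolev.intervalIntegrable (h : IntervalSobolev ℓ p u u') {x y : ℝ}
    (hx : x ∈ Icc 0 ℓ) (hy : y ∈ Icc 0 ℓ) : IntervalIntegrable u' volume x y := by
  rw [intervalIntegrable_iff]
  have h1 : IntegrableOn u' (Icc 0 ℓ) := (integrableOn_Icc_iff_integrableOn_Ioo ..).2 h.1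
  exact h1.mono_set (uIoc_subset_uIcc.trans (uIcc_subset_Icc hx hy))

lemma IntervalSobolev.sub (hp : 1 < p) (hu : IntervalSobolev ℓ p u u')
    (hw : IntervalSobolev ℓ p w w') :
    IntervalSobolev ℓ p (fun x => u x - w x) (fun x => u' x - w' x) := by
  refine ⟨hu.1.sub hw.1, ?_, fun x hx => ?_⟩
  · have := ((hu.memLp hp).sub (hw.memLp hp)).integrable_norm_rpow
      (by simp; linarith) ENNReal.ofReal_ne_top
    rw [ENNReal.toReal_ofReal (by linarith)] at this
    exact this
  · have h0 : (0 : ℝ) ∈ Icc 0 ℓ := ⟨le_rfl, hx.1.trans hx.2⟩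
    rw [intervalIntegral.integral_sub (hu.intervalIntegrable h0 hx)
      (hw.intervalIntegrable h0 hx)]
    linarith [hu.2.2 x hx, hw.2.2 x hx]

lemma IntervalSobolev.absolutelyContinuous_primitive (hℓ : 0 < ℓ)
    (h : IntervalSobolev ℓ p u u') :
    AbsolutelyContinuousOnInterval (fun x => ∫ t in (0 : ℝ)..x, u' t) 0 ℓ :=
  (h.intervalIntegrable (left_mem_Icc.2 hℓ.le)
    (right_mem_Icc.2 hℓ.le)).absolutelyContinuousOnInterval_intervalIntegral left_mem_uIcc

lemma IntervalSobolev.continuousOn (hℓ : 0 < ℓ) (h : IntervalSobolev ℓ p u u') :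
    ContinuousOn u (Icc 0 ℓ) := by
  have h1 := (h.absolutelyContinuous_primitive hℓ).continuousOn
  rw [uIcc_of_le hℓ.le] at h1
  exact (continuousOn_const.add h1).congr h.2.2

lemma AbsolutelyContinuousOnInterval.posPart_add_const {g : ℝ → ℝ} {a b : ℝ}
    (hg : AbsolutelyContinuousOnInterval g a b) (c : ℝ) :
    AbsolutelyContinuousOnInterval (fun x => max (g x + c) 0) a b := by
  refine squeeze_zero (fun E => Finset.sum_nonneg fun i _ => dist_nonneg) (fun E => ?_) hg
  refine Finset.sum_le_sum fun i _ => ?_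
  rw [Real.dist_eq, Real.dist_eq]
  refine (abs_max_sub_max_le_abs _ _ _).trans (le_of_eq ?_)
  congr 1
  ring

lemma IntervalSobolev.posPart_sub_const (hℓ : 0 < ℓ) (hp : 1 < p)
    (h : IntervalSobolev ℓ p w w') (k : ℝ) :
    ∃ φ', IntervalSobolev ℓ p (fun x => max (w x - k) 0) φ' ∧
      ∀ᵐ x ∂(volume.restrict (Ioo 0 ℓ)), φ' x = 0 ∨ φ' x = w' x := by
  set P : ℝ → ℝ := fun x => ∫ t in (0 : ℝ)..x, w' t with hP
  set Φ : ℝ → ℝ := fun x => max (P x + (w 0 - k)) 0 with hΦ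
  have hAC : AbsolutelyContinuousOnInterval Φ 0 ℓ :=
    (h.absolutelyContinuous_primitive hℓ).posPart_add_const _
  have hΦw : ∀ x ∈ Icc (0 : ℝ) ℓ, max (w x - k) 0 = Φ x := fun x hx => by
    rw [hΦ, h.2.2 x hx]
    congr 1
    ring
  have hint : IntegrableOn (deriv Φ) (Ioo 0 ℓ) := by
    have := hAC.intervalIntegrable_deriv
    rw [intervalIntegrable_iff_integrableOn_Ioo_of_le hℓ.le] at this
    exact this
  have hae : ∀ᵐ x ∂(volume.restrict (Ioo 0 ℓ)), deriv Φ x = 0 ∨ deriv Φ x = w' x := by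
    rw [ae_restrict_iff' measurableSet_Ioo]
    filter_upwards [hAC.ae_differentiableAt,
      (h.intervalIntegrable (left_mem_Icc.2 hℓ.le)
        (right_mem_Icc.2 hℓ.le)).ae_hasDerivAt_integral] with x hx1 hx2 hx
    have hxI : x ∈ uIcc 0 ℓ := by
      rw [uIcc_of_le hℓ.le]
      exact Ioo_subset_Icc_self hx
    have hd : HasDerivAt P (w' x) x := hx2 hxI 0 left_mem_uIcc
    have hc : ContinuousAt (fun y => P y + (w 0 - k)) x := hd.continuousAt.add continuousAt_const
    rcases lt_trichotomy (P x + (w 0 - k)) 0 with hlt | heq | hgt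
    · left
      have : Φ =ᶠ[nhds x] fun _ => 0 := by
        filter_upwards [hc.eventually_lt continuousAt_const hlt] with y hy
        exact max_eq_right hy.le
      rw [this.deriv_eq]
      simp
    · left
      apply IsLocalMin.deriv_eq_zero
      refine Filter.Eventually.of_forall fun y => ?_
      simp [hΦ, heq]
    · right
      have : Φ =ᶠ[nhds x] fun y => P y + (w 0 - k) := by
        filter_upwards [continuousAt_const.eventually_lt hc hgt] with y hy
        exact max_eq_left hy.le
      rw [this.deriv_eq]
      exact (hd.add_const _).deriv
  refine ⟨deriv Φ, ⟨hint, ?_, fun x hx => ?_⟩, hae⟩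
  · refine h.2.1.mono' ?_ ?_
    · exact ((hint.aestronglyMeasurable.aemeasurable.norm).pow_const p).aestronglyMeasurable
    · filter_upwards [hae] with x hx
      rw [Real.norm_of_nonneg (by positivity)]
      rcases hx with hx | hx <;> rw [hx]
      rw [abs_zero, Real.zero_rpow (by linarith)]
      positivity
  · have h0 : (0 : ℝ) ∈ Icc 0 ℓ := left_mem_Icc.2 hℓ.le
    have := (hAC.mono (uIcc_subset_uIcc left_mem_uIcc
      (by rwa [uIcc_of_le hℓ.le]) : uIcc 0 x ⊆ uIcc 0 ℓ)).integral_deriv_eq_sub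
    rw [this]
    linarith [hΦw x hx, hΦw 0 h0]

lemma IntervalSobolev.integrableOn_mul {g : ℝ → ℝ} (hℓ : 0 < ℓ) (h : IntervalSobolev ℓ p u u')
    (hg : IntegrableOn g (Ioo 0 ℓ)) : IntegrableOn (fun x => g x * u x) (Ioo 0 ℓ) := by
  rw [← integrableOn_Icc_iff_integrableOn_Ioo] at hg ⊢
  exact hg.mul_continuousOn (h.continuousOn hℓ) isCompact_Icc

lemma IntervalSobolev.integrableOn_rho_mul (hp : 1 < p) (hu : IntervalSobolev ℓ p u u')
    (hw : IntervalSobolev ℓ p w w') :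
    IntegrableOn (fun x => rho p (u' x) * w' x) (Ioo 0 ℓ) := by
  refine (hu.2.1.add hw.2.1).mono' ?_ (Eventually.of_forall fun x => ?_)
  · exact (((measurable_rho p).comp_aemeasurable hu.1.aestronglyMeasurable.aemeasurable).mul
      hw.1.aestronglyMeasurable.aemeasurable).aestronglyMeasurable
  · rw [Real.norm_eq_abs, abs_mul, abs_rho hp]
    exact abs_rpow_sub_one_mul_abs_le hp _ _

lemma IntervalSobolev.abs_sub_le (h : IntervalSobolev ℓ p u u')
    {θ C : ℝ} (hθ : 0 ≤ θ) (hC : ∀ r : ℝ, 0 ≤ r → r ^ (1 : ℝ) ≤ θ * r ^ p + C) {x y : ℝ}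
    (hx : x ∈ Icc 0 ℓ) (hy : y ∈ Icc 0 ℓ) :
    |u x - u y| ≤ θ * (∫ t in Ioo 0 ℓ, |u' t| ^ p) + C * |x - y| := by
  have h0 : (0 : ℝ) ∈ Icc 0 ℓ := ⟨le_rfl, hx.1.trans hx.2⟩
  have hpI : IntegrableOn (fun x => |u' x| ^ p) (Ioc 0 ℓ) :=
    (integrableOn_Ioc_iff_integrableOn_Ioo ..).2 h.2.1
  have hsub : uIoc y x ⊆ Ioc 0 ℓ := by
    rw [uIoc]
    exact Ioc_subset_Ioc (le_min hy.1 hx.1) (max_le hy.2 hx.2)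
  have e1 : u x - u y = ∫ t in y..x, u' t := by
    rw [h.2.2 x hx, h.2.2 y hy, ← intervalIntegral.integral_add_adjacent_intervals
      (h.intervalIntegrable h0 hy) (h.intervalIntegrable hy hx)]
    ring
  rw [e1, ← Real.norm_eq_abs]
  refine intervalIntegral.norm_integral_le_integral_norm_uIoc.trans ?_
  have hfin : volume (uIoc y x) ≠ ⊤ := by rw [uIoc]; simp
  calc ∫ t in uIoc y x, ‖u' t‖ ≤ ∫ t in uIoc y x, (θ * |u' t| ^ p + C) := by
        refine setIntegral_mono (intervalIntegrable_iff.1 (h.intervalIntegrable hy hx)).norm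
          (((hpI.mono_set hsub).const_mul θ).add (integrableOn_const hfin)) fun t => ?_
        have := hC |u' t| (abs_nonneg _)
        rwa [Real.rpow_one] at this
    _ = θ * (∫ t in uIoc y x, |u' t| ^ p) + C * |x - y| := by
        rw [integral_add ((hpI.mono_set hsub).const_mul θ) (integrableOn_const hfin),
          integral_const_mul, setIntegral_const, Measure.real, uIoc, Real.volume_Ioc,
          ENNReal.toReal_ofReal (by simp), max_sub_min_eq_abs]
        simp [mul_comm]
    _ ≤ θ * (∫ t in Ioo 0 ℓ, |u' t| ^ p) + C * |x - y| := by
        rw [← integral_Ioc_eq_integral_Ioo]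
        have := setIntegral_mono_set hpI
          (Eventually.of_forall fun t => by simp only [Pi.zero_apply]; positivity)
          hsub.eventuallyLE
        exact add_le_add_left (mul_le_mul_of_nonneg_left this hθ) _

end IntervalSobolev

lemma eqOn_zero_of_setIntegral_eq_zero {ℓ : ℝ} (hℓ : 0 < ℓ) {g : ℝ → ℝ}
    (hg : ContinuousOn g (Icc 0 ℓ)) (hg0 : ∀ x ∈ Icc 0 ℓ, 0 ≤ g x)
    (h : ∫ x in Ioo 0 ℓ, g x = 0) : ∀ x ∈ Icc 0 ℓ, g x = 0 := by
  rw [← integral_Icc_eq_integral_Ioo, setIntegral_eq_zero_iff_of_nonneg_ae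
    ((ae_restrict_iff' measurableSet_Icc).2 (Eventually.of_forall hg0))
    (hg.integrableOn_compact isCompact_Icc)] at h
  exact Measure.eqOn_Icc_of_ae_eq volume hℓ.ne h hg continuousOn_const

lemma exists_pos_le_monotone_mul {g : ℝ → ℝ} (hgc : Continuous g) (hgm : StrictMono g) (M : ℝ)
    {η : ℝ} (hη : 0 < η) :
    ∃ c, 0 < c ∧ ∀ a b : ℝ, |a| ≤ M → |b| ≤ M → η ≤ |a - b| → c ≤ (g a - g b) * (a - b) := by
  set K : Set (ℝ × ℝ) := (Icc (-M) M ×ˢ Icc (-M) M) ∩ {z | η ≤ |z.1 - z.2|} with hK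
  have hKc : IsCompact K := (isCompact_Icc.prod isCompact_Icc).inter_right
    (isClosed_le continuous_const (by fun_prop))
  have hmem : ∀ a b : ℝ, |a| ≤ M → |b| ≤ M → η ≤ |a - b| → (a, b) ∈ K := fun a b ha hb hab =>
    ⟨⟨abs_le.1 ha, abs_le.1 hb⟩, hab⟩
  rcases K.eq_empty_or_nonempty with hE | hN
  · refine ⟨1, one_pos, fun a b ha hb hab => ?_⟩
    have := hmem a b ha hb hab
    rw [hE] at this
    exact this.elim
  · obtain ⟨z, hz, hmin⟩ := hKc.exists_isMinOn hN
      (f := fun z : ℝ × ℝ => (g z.1 - g z.2) * (z.1 - z.2)) (by fun_prop)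
    refine ⟨(g z.1 - g z.2) * (z.1 - z.2), ?_, fun a b ha hb hab => hmin (hmem a b ha hb hab)⟩
    have hne : z.1 ≠ z.2 := fun h => by
      have := hz.2
      simp only [mem_ofPred_eq, h, sub_self, abs_zero] at this
      linarith
    rcases lt_or_gt_of_ne hne with h | h
    · exact mul_pos_of_neg_of_neg (sub_neg.2 (hgm h)) (sub_neg.2 h)
    · exact mul_pos (sub_pos.2 (hgm h)) (sub_pos.2 h)

/-- Functions with bounded energy that differ by at least `η` at `s` are separated, in the sense
of the monotone pairing with `g`, by an amount depending only on the bounds. -/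
lemma exists_pos_le_integral_monotone_mul {ℓ p : ℝ} (hℓ : 0 < ℓ) (hp : 1 < p) {g : ℝ → ℝ}
    (hgc : Continuous g) (hgm : StrictMono g) (M A : ℝ) {η s : ℝ} (hη : 0 < η)
    (hs : s ∈ Icc 0 ℓ) :
    ∃ κ, 0 < κ ∧ ∀ u u' w w' : ℝ → ℝ, IntervalSobolev ℓ p u u' → IntervalSobolev ℓ p w w' →
      (∀ x ∈ Icc 0 ℓ, |u x| ≤ M) → (∀ x ∈ Icc 0 ℓ, |w x| ≤ M) →
      (∫ x in Ioo 0 ℓ, |u' x| ^ p) ≤ A → (∫ x in Ioo 0 ℓ, |w' x| ^ p) ≤ A →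
      η ≤ |u s - w s| → κ ≤ ∫ x in Ioo 0 ℓ, (g (u x) - g (w x)) * (u x - w x) := by
  obtain ⟨c, hc, hcle⟩ := exists_pos_le_monotone_mul hgc hgm M (half_pos hη)
  set θ := η / (8 * (|A| + 1)) with hθdef
  have hθ : 0 < θ := by positivity
  obtain ⟨C, hC0, hC⟩ := exists_rpow_le_mul_rpow_add one_pos hp hθ
  set h := min ℓ (η / (8 * (C + 1))) with hh
  have hh0 : 0 < h := lt_min hℓ (by positivity)
  refine ⟨c * h, by positivity, fun u u' w w' hu hw hMu hMw hAu hAw hη' => ?_⟩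
  have osc : ∀ v v' : ℝ → ℝ, IntervalSobolev ℓ p v v' → (∫ x in Ioo 0 ℓ, |v' x| ^ p) ≤ A →
      ∀ x ∈ Icc 0 ℓ, |x - s| ≤ h → |v x - v s| ≤ η / 4 := by
    intro v v' hv hA x hx hxs
    have h1 := hv.abs_sub_le hθ.le hC hx hs
    have h2 : θ * (∫ t in Ioo 0 ℓ, |v' t| ^ p) ≤ η / 8 := by
      calc θ * (∫ t in Ioo 0 ℓ, |v' t| ^ p) ≤ θ * (|A| + 1) := by
            gcongr
            linarith [le_abs_self A]
        _ = η / 8 := by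
            rw [hθdef]
            field_simp
    have h3 : C * |x - s| ≤ η / 8 := by
      calc C * |x - s| ≤ (C + 1) * (η / (8 * (C + 1))) := by
            gcongr
            · linarith
            · exact hxs.trans (min_le_right _ _)
        _ = η / 8 := by field_simp
    linarith
  have hcont : ContinuousOn (fun x => (g (u x) - g (w x)) * (u x - w x)) (Icc 0 ℓ) :=
    ((hgc.comp_continuousOn (hu.continuousOn hℓ)).sub
      (hgc.comp_continuousOn (hw.continuousOn hℓ))).mul
      ((hu.continuousOn hℓ).sub (hw.continuousOn hℓ))
  have hint : IntegrableOn (fun x => (g (u x) - g (w x)) * (u x - w x)) (Ioo 0 ℓ) :=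
    (hcont.integrableOn_compact isCompact_Icc).mono_set Ioo_subset_Icc_self
  set S := Ioo (max 0 (s - h)) (min ℓ (s + h)) with hS
  have hSsub : S ⊆ Ioo 0 ℓ := Ioo_subset_Ioo (le_max_left _ _) (min_le_left _ _)
  have hvol : h ≤ volume.real S := by
    have : h ≤ min ℓ (s + h) - max 0 (s - h) := by
      have := min_le_left ℓ (η / (8 * (C + 1)))
      rcases le_total ℓ (s + h) with h1 | h1 <;> rcases le_total 0 (s - h) with h2 | h2 <;>
        simp only [h1, h2, min_eq_left, min_eq_right, max_eq_left, max_eq_right] <;>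
        linarith [hs.1, hs.2]
    rw [Measure.real, hS, Real.volume_Ioo, ENNReal.toReal_ofReal (by linarith)]
    exact this
  calc c * h ≤ c * volume.real S := by gcongr
    _ = ∫ _ in S, c := by simp [mul_comm]
    _ ≤ ∫ x in S, (g (u x) - g (w x)) * (u x - w x) := by
        refine setIntegral_mono_on (integrableOn_const (by simp [hS])) (hint.mono_set hSsub)
          measurableSet_Ioo fun x hx => ?_
        have hx' : x ∈ Icc 0 ℓ := Ioo_subset_Icc_self (hSsub hx)
        have hxs : |x - s| ≤ h := by
          have h1 := (le_max_right _ _).trans_lt hx.1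
          have h2 := hx.2.trans_le (min_le_right _ _)
          rw [abs_le]
          constructor <;> linarith
        refine hcle _ _ (hMu x hx') (hMw x hx') ?_
        have h1 := abs_le.1 (osc u u' hu hAu x hx' hxs)
        have h2 := abs_le.1 (osc w w' hw hAw x hx' hxs)
        rcases le_abs.1 hη' with h3 | h3
        · exact le_abs.2 (Or.inl (by linarith))
        · exact le_abs.2 (Or.inr (by linarith))
    _ ≤ ∫ x in Ioo 0 ℓ, (g (u x) - g (w x)) * (u x - w x) :=
        setIntegral_mono_set hint
          (Eventually.of_forall fun x => hgm.monotone.sub_mul_sub_nonneg _ _) hSsub.eventuallyLE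

section edgeSum

variable {G : MetricGraph}

lemma edgeSum_sub (F H : G.E → ℝ) :
    edgeSum G (fun e => F e - H e) = edgeSum G F - edgeSum G H :=
  letI := G.fintypeE
  Finset.sum_sub_distrib ..

lemma edgeSum_le_edgeSum {F H : G.E → ℝ} (h : ∀ e, F e ≤ H e) : edgeSum G F ≤ edgeSum G H :=
  letI := G.fintypeE
  Finset.sum_le_sum fun e _ => h e

lemma edgeSum_nonneg {F : G.E → ℝ} (h : ∀ e, 0 ≤ F e) : 0 ≤ edgeSum G F :=
  letI := G.fintypeE
  Finset.sum_nonneg fun e _ => h e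

lemma le_edgeSum {F : G.E → ℝ} (h : ∀ e, 0 ≤ F e) (e : G.E) : F e ≤ edgeSum G F :=
  letI := G.fintypeE
  Finset.single_le_sum (f := F) (fun e _ => h e) (Finset.mem_univ e)

lemma eq_zero_of_edgeSum_nonpos {F : G.E → ℝ} (h : ∀ e, 0 ≤ F e) (h0 : edgeSum G F ≤ 0)
    (e : G.E) : F e = 0 :=
  le_antisymm ((le_edgeSum h e).trans h0) (h e)

lemma edgeSum_eq_single {F : G.E → ℝ} (e₀ : G.E) (h : ∀ e, e ≠ e₀ → F e = 0) :
    edgeSum G F = F e₀ :=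
  letI := G.fintypeE
  Finset.sum_eq_single e₀ (fun e _ he => h e he) (fun he => (he (Finset.mem_univ _)).elim)

lemma vertexSum_add (F H : G.V → ℝ) :
    vertexSum G (fun v => F v + H v) = vertexSum G F + vertexSum G H :=
  letI := G.fintypeV
  Finset.sum_add_distrib

lemma vertexSum_sub (F H : G.V → ℝ) :
    vertexSum G (fun v => F v - H v) = vertexSum G F - vertexSum G H :=
  letI := G.fintypeV
  Finset.sum_sub_distrib ..

lemma vertexSum_le_vertexSum {F H : G.V → ℝ} (h : ∀ v, F v ≤ H v) :
    vertexSum G F ≤ vertexSum G H :=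
  letI := G.fintypeV
  Finset.sum_le_sum fun v _ => h v

lemma vertexSum_eq_single {F : G.V → ℝ} (a : G.V) (h : ∀ v, v ≠ a → F v = 0) :
    vertexSum G F = F a :=
  letI := G.fintypeV
  Finset.sum_eq_single a (fun v _ hv => h v hv) (fun hv => (hv (Finset.mem_univ _)).elim)

end edgeSum

/-- The parameter `s` of the edge `e` corresponds to the vertex `a`. -/
def IsEndpoint (G : MetricGraph) (e : G.E) (s : ℝ) (a : G.V) : Prop :=
  (s = 0 ∧ G.ι e = a) ∨ (s = G.len e ∧ G.τ e = a)

lemma IsEndpoint.mem_Icc {G : MetricGraph} {e : G.E} {s : ℝ} {a : G.V}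
    (h : IsEndpoint G e s a) : s ∈ Icc 0 (G.len e) := by
  rcases h with ⟨rfl, -⟩ | ⟨rfl, -⟩
  · exact left_mem_Icc.2 (G.len_pos e).le
  · exact right_mem_Icc.2 (G.len_pos e).le

lemma exists_isEndpoint {G : MetricGraph} {v w : G.V} (hvw : v ≠ w) (a : G.V) :
    ∃ e s, IsEndpoint G e s a := by
  obtain ⟨b, hab⟩ : ∃ b, a ≠ b := by
    by_cases h : a = v
    · exact ⟨w, h ▸ hvw⟩
    · exact ⟨v, h⟩
  rcases (G.connected a b).cases_head with h | ⟨c, ⟨e, he | he⟩, -⟩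
  · exact (hab h).elim
  · exact ⟨e, 0, Or.inl ⟨rfl, he.1⟩⟩
  · exact ⟨e, G.len e, Or.inr ⟨rfl, he.2⟩⟩

section Graph

variable {G : MetricGraph} {p : G.E → ℝ} {γ f : G.E → ℝ → ℝ} {ω₁ ω₂ : G.V → ℝ}
  {u u' w w' φ φ' : G.E → ℝ → ℝ} {uV wV φV : G.V → ℝ}

lemma GraphSobolev.apply_endpoint (h : GraphSobolev G p φ φ' φV) {e : G.E} {s : ℝ} {a : G.V}
    (hs : IsEndpoint G e s a) : φ e s = φV a := by
  rcases hs with ⟨rfl, rfl⟩ | ⟨rfl, rfl⟩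
  · exact h.2.1 e
  · exact h.2.2 e

lemma graphSobolev_const (hp : ∀ e, 1 < p e) (c : ℝ) :
    GraphSobolev G p (fun _ _ => c) (fun _ _ => 0) (fun _ => c) :=
  ⟨fun e => intervalSobolev_const (hp e) c, fun _ => rfl, fun _ => rfl⟩

lemma GraphSobolev.sub (hp : ∀ e, 1 < p e) (hu : GraphSobolev G p u u' uV)
    (hw : GraphSobolev G p w w' wV) :
    GraphSobolev G p (fun e x => u e x - w e x) (fun e x => u' e x - w' e x)
      (fun a => uV a - wV a) :=
  ⟨fun e => (hu.1 e).sub (hp e) (hw.1 e), fun e => by simp only [hu.2.1, hw.2.1],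
    fun e => by simp only [hu.2.2, hw.2.2]⟩

lemma GraphSobolev.posPart_sub_const (hp : ∀ e, 1 < p e) (h : GraphSobolev G p w w' wV) (k : ℝ) :
    ∃ φ', GraphSobolev G p (fun e x => max (w e x - k) 0) φ' (fun a => max (wV a - k) 0) ∧
      ∀ e, ∀ᵐ x ∂(volume.restrict (Ioo 0 (G.len e))), φ' e x = 0 ∨ φ' e x = w' e x := by
  choose φ' hφ' hae using fun e => (h.1 e).posPart_sub_const (G.len_pos e) (hp e) k
  exact ⟨φ', ⟨hφ', fun e => by simp only [h.2.1], fun e => by simp only [h.2.2]⟩, hae⟩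

/-- The difference of the weak formulations satisfied by two solutions. -/
lemma SolvesGraphProblem.sub_eq (hp : ∀ e, 1 < p e)
    (hu : SolvesGraphProblem G p γ f ω₁ (fun e x => γ e (u e x)) u u' uV)
    (hw : SolvesGraphProblem G p γ f ω₂ (fun e x => γ e (w e x)) w w' wV)
    (hφ : GraphSobolev G p φ φ' φV) :
    edgeSum G (fun e => ∫ x in Ioo 0 (G.len e), (γ e (u e x) - γ e (w e x)) * φ e x)
      + edgeSum G (fun e => ∫ x in Ioo 0 (G.len e),
          (rho (p e) (u' e x) - rho (p e) (w' e x)) * φ' e x)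
      = vertexSum G (fun a => (ω₁ a - ω₂ a) * φV a) := by
  have h1 := hu.2.2.2 φ φ' φV hφ
  have h2 := hw.2.2.2 φ φ' φV hφ
  have e1 : ∀ e, ∫ x in Ioo 0 (G.len e), (γ e (u e x) - γ e (w e x)) * φ e x
      = (∫ x in Ioo 0 (G.len e), γ e (u e x) * φ e x)
        - ∫ x in Ioo 0 (G.len e), γ e (w e x) * φ e x := fun e => by
    simp only [sub_mul]
    exact integral_sub ((hφ.1 e).integrableOn_mul (G.len_pos e) (hu.1 e))
      ((hφ.1 e).integrableOn_mul (G.len_pos e) (hw.1 e))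
  have e2 : ∀ e, ∫ x in Ioo 0 (G.len e), (rho (p e) (u' e x) - rho (p e) (w' e x)) * φ' e x
      = (∫ x in Ioo 0 (G.len e), rho (p e) (u' e x) * φ' e x)
        - ∫ x in Ioo 0 (G.len e), rho (p e) (w' e x) * φ' e x := fun e => by
    simp only [sub_mul]
    exact integral_sub ((hu.2.1.1 e).integrableOn_rho_mul (hp e) (hφ.1 e))
      ((hw.2.1.1 e).integrableOn_rho_mul (hp e) (hφ.1 e))
  have e3 : vertexSum G (fun a => (ω₁ a - ω₂ a) * φV a)
      = vertexSum G (fun a => ω₁ a * φV a) - vertexSum G (fun a => ω₂ a * φV a) := by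
    simp only [sub_mul, vertexSum_sub]
  rw [e3]
  simp only [e1, e2, edgeSum_sub]
  linarith

/-- Comparison principle: if the flux of `u` exceeds that of `w` by an amount `c ≥ 0` moved from
`b` to `a`, then `u - w` attains its maximum, which is nonnegative, at `a`. -/
lemma SolvesGraphProblem.sub_le (hp : ∀ e, 1 < p e)
    (hγ : ∀ e, Continuous (γ e) ∧ StrictMono (γ e))
    (hu : SolvesGraphProblem G p γ f ω₁ (fun e x => γ e (u e x)) u u' uV)
    (hw : SolvesGraphProblem G p γ f ω₂ (fun e x => γ e (w e x)) w w' wV)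
    {c : ℝ} (hc : 0 ≤ c) {a b : G.V}
    (hω : ∀ ψ : G.V → ℝ, vertexSum G (fun v => (ω₁ v - ω₂ v) * ψ v) = c * (ψ a - ψ b))
    {e₀ : G.E} {s : ℝ} (hs : IsEndpoint G e₀ s a) :
    0 ≤ uV a - wV a ∧ ∀ e, ∀ x ∈ Icc 0 (G.len e), u e x - w e x ≤ uV a - wV a := by
  have hd := hu.2.1.sub hp hw.2.1
  have hcont : ∀ e, ContinuousOn (fun x => γ e (u e x) - γ e (w e x)) (Icc 0 (G.len e)) :=
    fun e => ((hγ e).1.comp_continuousOn ((hu.2.1.1 e).continuousOn (G.len_pos e))).sub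
      ((hγ e).1.comp_continuousOn ((hw.2.1.1 e).continuousOn (G.len_pos e)))
  set k := max (uV a - wV a) 0 with hk
  have hk0 : 0 ≤ k := le_max_right _ _
  have bound : ∀ e, ∀ x ∈ Icc 0 (G.len e), u e x - w e x ≤ k := by
    obtain ⟨φ', hφ, hae⟩ := hd.posPart_sub_const hp k
    have key := hu.sub_eq hp hw hφ
    rw [hω] at key
    have hpos : ∀ e x, 0 ≤ (γ e (u e x) - γ e (w e x)) * max (u e x - w e x - k) 0 := by
      intro e x
      rcases le_total (u e x - w e x - k) 0 with h | h
      · rw [max_eq_right h, mul_zero]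
      · exact mul_nonneg (sub_nonneg.2 ((hγ e).2.monotone (by linarith))) (le_max_right _ _)
    have h2 : 0 ≤ edgeSum G (fun e => ∫ x in Ioo 0 (G.len e),
        (rho (p e) (u' e x) - rho (p e) (w' e x)) * φ' e x) := by
      refine edgeSum_nonneg fun e => integral_nonneg_of_ae ?_
      filter_upwards [hae e] with x hx
      rcases hx with hx | hx <;> rw [hx]
      · simp
      · exact (rho_monotone (hp e)).sub_mul_sub_nonneg _ _
    have h3 : c * (max (uV a - wV a - k) 0 - max (uV b - wV b - k) 0) ≤ 0 := by
      rw [max_eq_right (by linarith [le_max_left (uV a - wV a) 0] : uV a - wV a - k ≤ 0)]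
      exact mul_nonpos_of_nonneg_of_nonpos hc (by linarith [le_max_right (uV b - wV b - k) 0])
    intro e x hx
    have h4 := eq_zero_of_edgeSum_nonpos (fun e => integral_nonneg (hpos e)) (by linarith) e
    have h5 := eqOn_zero_of_setIntegral_eq_zero (G.len_pos e)
      ((hcont e).mul ((hφ.1 e).continuousOn (G.len_pos e))) (fun x _ => hpos e x) h4 x hx
    by_contra! hlt
    have h6 : 0 < γ e (u e x) - γ e (w e x) := sub_pos.2 ((hγ e).2 (by linarith))
    have h7 : 0 < max (u e x - w e x - k) 0 := lt_max_of_lt_left (by linarith)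
    exact (mul_pos h6 h7).ne' h5
  have hnn : 0 ≤ uV a - wV a := by
    by_contra! hneg
    have hk' : k = 0 := max_eq_right hneg.le
    have key := hu.sub_eq hp hw (graphSobolev_const hp (-1))
    rw [hω, sub_self, mul_zero] at key
    simp only [mul_zero, integral_zero] at key
    have hz : edgeSum G (fun _ => (0 : ℝ)) = 0 :=
      letI := G.fintypeE
      Finset.sum_const_zero
    rw [hz, add_zero] at key
    have hpos : ∀ e, ∀ x ∈ Icc 0 (G.len e), 0 ≤ (γ e (u e x) - γ e (w e x)) * (-1 : ℝ) := by
      intro e x hx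
      have := (hγ e).2.monotone (by linarith [bound e x hx] : u e x ≤ w e x)
      linarith
    have h4 := eq_zero_of_edgeSum_nonpos (fun e => setIntegral_nonneg measurableSet_Ioo
      fun x hx => hpos e x (Ioo_subset_Icc_self hx)) key.le e₀
    have h5 := eqOn_zero_of_setIntegral_eq_zero (G.len_pos e₀)
      ((hcont e₀).mul continuousOn_const) (hpos e₀) h4 s hs.mem_Icc
    simp only [Pi.mul_apply, hu.2.1.apply_endpoint hs, hw.2.1.apply_endpoint hs] at h5
    have := (hγ e₀).2 (by linarith : uV a < wV a)
    linarith
  refine ⟨hnn, fun e x hx => ?_⟩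
  rw [← max_eq_left hnn]
  exact bound e x hx

/-- Energy estimate for a solution bounded by `M`. -/
lemma SolvesGraphProblem.energy_le (hp : ∀ e, 1 < p e)
    (hγ : ∀ e, Monotone (γ e) ∧ γ e 0 = 0)
    (hf : ∀ e, IntegrableOn (f e) (Ioo 0 (G.len e)) volume)
    (hu : SolvesGraphProblem G p γ f ω₁ (fun e x => γ e (u e x)) u u' uV) {M : ℝ}
    (hM : ∀ e, ∀ x ∈ Icc 0 (G.len e), |u e x| ≤ M) (e₀ : G.E) :
    (∫ x in Ioo 0 (G.len e₀), |u' e₀ x| ^ p e₀) ≤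
      edgeSum G (fun e => ∫ x in Ioo 0 (G.len e), |f e x| * M)
        + vertexSum G (fun a => ω₁ a * uV a) := by
  have key := hu.2.2.2 u u' uV hu.2.1
  simp only [fun e => rho_mul_self (hp e)] at key
  have h1 : 0 ≤ edgeSum G (fun e => ∫ x in Ioo 0 (G.len e), γ e (u e x) * u e x) :=
    edgeSum_nonneg fun e => integral_nonneg fun x => by
      have := (hγ e).1.sub_mul_sub_nonneg (u e x) 0
      rwa [(hγ e).2, sub_zero, sub_zero] at this
  have h2 : edgeSum G (fun e => ∫ x in Ioo 0 (G.len e), f e x * u e x) ≤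
      edgeSum G (fun e => ∫ x in Ioo 0 (G.len e), |f e x| * M) :=
    edgeSum_le_edgeSum fun e => setIntegral_mono_on
      ((hu.2.1.1 e).integrableOn_mul (G.len_pos e) (hf e)) ((hf e).abs.mul_const M)
      measurableSet_Ioo fun x hx => (le_abs_self _).trans (by
        rw [abs_mul]
        exact mul_le_mul_of_nonneg_left (hM e x (Ioo_subset_Icc_self hx)) (abs_nonneg _))
  have h3 := le_edgeSum (F := fun e => ∫ x in Ioo 0 (G.len e), |u' e x| ^ p e)
    (fun e => integral_nonneg fun x => Real.rpow_nonneg (abs_nonneg _) _) e₀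
  linarith

end Graph

lemma intervalSobolev_const_mul (ℓ p c : ℝ) :
    IntervalSobolev ℓ p (fun x => c * x) (fun _ => c) := by
  refine ⟨integrableOn_const (by simp), integrableOn_const (by simp), fun x _ => ?_⟩
  simp [mul_comm]

lemma vertexSum_transfer {G : MetricGraph} {ω₁ ω₂ : G.V → ℝ} {a b : G.V} (hab : a ≠ b) {c : ℝ}
    (ha : ω₁ a - ω₂ a = c) (hb : ω₁ b - ω₂ b = -c)
    (hω : ∀ v, v ≠ a → v ≠ b → ω₁ v - ω₂ v = 0) (ψ : G.V → ℝ) :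
    vertexSum G (fun v => (ω₁ v - ω₂ v) * ψ v) = c * (ψ a - ψ b) := by
  classical
  have h1 : ∀ v, (ω₁ v - ω₂ v) * ψ v
      = (if v = a then c * ψ a else 0) + (if v = b then -c * ψ b else 0) := by
    intro v
    by_cases hva : v = a
    · subst hva
      simp [hab, ha]
    · by_cases hvb : v = b
      · subst hvb
        simp [hva, hb]
      · simp [hva, hvb, hω v hva hvb]
  simp only [h1]
  rw [vertexSum_add, vertexSum_eq_single a (fun v hv => if_neg hv),
    vertexSum_eq_single b (fun v hv => if_neg hv), if_pos rfl, if_pos rfl]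
  ring

/-- The flux at a terminal vertex of degree one is controlled by the energy on its edge. -/
lemma SolvesGraphProblem.flux_le {G : MetricGraph} {p : G.E → ℝ} {γ f : G.E → ℝ → ℝ}
    {ω : G.V → ℝ} {u u' : G.E → ℝ → ℝ} {uV : G.V → ℝ} (hp : ∀ e, 1 < p e)
    (hf : ∀ e, IntegrableOn (f e) (Ioo 0 (G.len e)) volume)
    (hu : SolvesGraphProblem G p γ f ω (fun e x => γ e (u e x)) u u' uV)
    {e₀ : G.E} (hdeg : ∀ e, (G.ι e = G.τ e₀ ∨ G.τ e = G.τ e₀) → e = e₀) {Γ θ C : ℝ}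
    (hΓ : ∀ x ∈ Icc 0 (G.len e₀), |γ e₀ (u e₀ x)| ≤ Γ)
    (hC : ∀ r : ℝ, 0 ≤ r → r ^ (p e₀ - 1) ≤ θ * r ^ p e₀ + C) :
    ω (G.τ e₀) ≤ Γ * G.len e₀ + (∫ x in Ioo 0 (G.len e₀), |f e₀ x|)
      + (G.len e₀)⁻¹ * (θ * (∫ x in Ioo 0 (G.len e₀), |u' e₀ x| ^ p e₀) + C * G.len e₀) := by
  classical
  have hℓ := G.len_pos e₀
  set ℓ := G.len e₀ with hℓdef
  have hφ : GraphSobolev G p (fun e x => (if e = e₀ then ℓ⁻¹ else 0) * x)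
      (fun e _ => if e = e₀ then ℓ⁻¹ else 0) (fun v => if v = G.τ e₀ then 1 else 0) := by
    refine ⟨fun e => intervalSobolev_const_mul _ _ _, fun e => ?_, fun e => ?_⟩
    · have : G.ι e ≠ G.τ e₀ := fun h => G.no_loops e (by
        rw [h, hdeg e (Or.inl h)])
      simp [this]
    · by_cases he : e = e₀
      · subst he
        simp [← hℓdef, hℓ.ne']
      · have : G.τ e ≠ G.τ e₀ := fun h => he (hdeg e (Or.inr h))
        simp [this, he]
  have key := hu.2.2.2 _ _ _ hφ
  rw [edgeSum_eq_single e₀ (fun e he => by simp [he]),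
    edgeSum_eq_single e₀ (fun e he => by simp [he]),
    edgeSum_eq_single e₀ (fun e he => by simp [he]),
    vertexSum_eq_single (G.τ e₀) (fun v hv => by simp [hv])] at key
  simp only [if_true, mul_one, ← hℓdef] at key
  have hφ₀ := hφ.1 e₀
  simp only [if_true, ← hℓdef] at hφ₀
  have hx1 : ∀ x ∈ Ioo 0 ℓ, |ℓ⁻¹ * x| ≤ 1 := fun x hx => by
    rw [abs_of_nonneg (mul_nonneg (by positivity) hx.1.le), inv_mul_le_iff₀ hℓ, mul_one]
    exact hx.2.le
  have hu₀ := hu.2.1.1 e₀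
  have hfin : volume (Ioo 0 ℓ) ≠ ⊤ := by simp
  have i1 : ∫ x in Ioo 0 ℓ, γ e₀ (u e₀ x) * (ℓ⁻¹ * x) ≤ Γ * ℓ := by
    calc ∫ x in Ioo 0 ℓ, γ e₀ (u e₀ x) * (ℓ⁻¹ * x) ≤ ∫ _ in Ioo 0 ℓ, Γ := by
          refine setIntegral_mono_on (hφ₀.integrableOn_mul hℓ (hu.1 e₀))
            (integrableOn_const hfin) measurableSet_Ioo fun x hx => ?_
          have hΓx := hΓ x (Ioo_subset_Icc_self hx)
          refine (le_abs_self _).trans ?_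
          rw [abs_mul]
          exact (mul_le_of_le_one_right (abs_nonneg _) (hx1 x hx)).trans hΓx
      _ = Γ * ℓ := by simp [hℓ.le, mul_comm]
  have i2 : -(∫ x in Ioo 0 ℓ, |f e₀ x|) ≤ ∫ x in Ioo 0 ℓ, f e₀ x * (ℓ⁻¹ * x) := by
    rw [← integral_neg]
    refine setIntegral_mono_on (hf e₀).abs.neg (hφ₀.integrableOn_mul hℓ (hf e₀))
      measurableSet_Ioo fun x hx => ?_
    refine le_trans ?_ (neg_abs_le _)
    rw [abs_mul]
    exact neg_le_neg (mul_le_of_le_one_right (abs_nonneg _) (hx1 x hx))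
  have i2' : ∫ x in Ioo 0 ℓ, -(f e₀ x * (ℓ⁻¹ * x)) ≤ ∫ x in Ioo 0 ℓ, |f e₀ x| := by
    rw [integral_neg]
    linarith
  have i3 : ∫ x in Ioo 0 ℓ, rho (p e₀) (u' e₀ x) * ℓ⁻¹
      ≤ ℓ⁻¹ * (θ * (∫ x in Ioo 0 ℓ, |u' e₀ x| ^ p e₀) + C * ℓ) := by
    calc ∫ x in Ioo 0 ℓ, rho (p e₀) (u' e₀ x) * ℓ⁻¹
        ≤ ∫ x in Ioo 0 ℓ, ℓ⁻¹ * (θ * |u' e₀ x| ^ p e₀ + C) := by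
          refine setIntegral_mono_on (hu₀.integrableOn_rho_mul (hp e₀) hφ₀)
            (((hu₀.2.1.const_mul θ).add (integrableOn_const hfin)).const_mul _)
            measurableSet_Ioo fun x _ => ?_
          rw [mul_comm]
          refine mul_le_mul_of_nonneg_left ?_ (by positivity)
          exact ((le_abs_self _).trans_eq (abs_rho (hp e₀) _)).trans (hC _ (abs_nonneg _))
      _ = ℓ⁻¹ * (θ * (∫ x in Ioo 0 ℓ, |u' e₀ x| ^ p e₀) + C * ℓ) := by
          rw [integral_const_mul, integral_add (hu₀.2.1.const_mul θ) (integrableOn_const hfin),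
            integral_const_mul]
          rw [setIntegral_const, Measure.real, Real.volume_Ioo, sub_zero, ENNReal.toReal_ofReal hℓ.le,
            smul_eq_mul, mul_comm ℓ C]
  linarith

section FluxFamily

variable {G : MetricGraph} {p : G.E → ℝ} {γ f : G.E → ℝ → ℝ} {ωε : ℝ → G.V → ℝ}
  {u u' : ℝ → G.E → ℝ → ℝ} {uV : ℝ → G.V → ℝ} {a b : G.V}

lemma flux_family_sub_le (hp : ∀ e, 1 < p e)
    (hγ : ∀ e, Continuous (γ e) ∧ StrictMono (γ e)) (hab : a ≠ b)
    (hflux : ∀ ε δ : ℝ, ∀ ψ : G.V → ℝ,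
      vertexSum G (fun v => (ωε ε v - ωε δ v) * ψ v) = (ε - δ) * (ψ a - ψ b))
    (hsol : ∀ ε : ℝ, 0 ≤ ε → SolvesGraphProblem G p γ f (ωε ε)
      (fun e x => γ e (u ε e x)) (u ε) (u' ε) (uV ε))
    {δ ε : ℝ} (hδ : 0 ≤ δ) (hδε : δ ≤ ε) :
    (0 ≤ uV ε a - uV δ a ∧
      ∀ e, ∀ x ∈ Icc 0 (G.len e), u ε e x - u δ e x ≤ uV ε a - uV δ a) ∧
    (0 ≤ uV δ b - uV ε b ∧
      ∀ e, ∀ x ∈ Icc 0 (G.len e), u δ e x - u ε e x ≤ uV δ b - uV ε b) := by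
  obtain ⟨ea, sa, hsa⟩ := exists_isEndpoint hab a
  obtain ⟨eb, sb, hsb⟩ := exists_isEndpoint hab b
  have hε := hδ.trans hδε
  refine ⟨(hsol ε hε).sub_le hp hγ (hsol δ hδ) (sub_nonneg.2 hδε) (hflux ε δ) hsa,
    (hsol δ hδ).sub_le hp hγ (hsol ε hε) (sub_nonneg.2 hδε) (b := a) (fun ψ => ?_) hsb⟩
  rw [hflux]
  ring

/-- As long as the values at `a` and `b` stay within `K` of their initial values, the solutions
stay bounded and their energies grow at most linearly. -/
lemma flux_family_bounds (hp : ∀ e, 1 < p e)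
    (hγ : ∀ e, Continuous (γ e) ∧ StrictMono (γ e) ∧ Function.Surjective (γ e) ∧ γ e 0 = 0)
    (hf : ∀ e, IntegrableOn (f e) (Ioo 0 (G.len e)) volume) (hab : a ≠ b)
    (hflux : ∀ ε δ : ℝ, ∀ ψ : G.V → ℝ,
      vertexSum G (fun v => (ωε ε v - ωε δ v) * ψ v) = (ε - δ) * (ψ a - ψ b))
    (hsol : ∀ ε : ℝ, 0 ≤ ε → SolvesGraphProblem G p γ f (ωε ε)
      (fun e x => γ e (u ε e x)) (u ε) (u' ε) (uV ε)) {K : ℝ} (hK : 0 ≤ K) :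
    ∃ M A : ℝ, 0 ≤ M ∧ ∀ ε, 0 ≤ ε → uV ε a - uV 0 a ≤ K → uV 0 b - uV ε b ≤ K →
      (∀ e, ∀ x ∈ Icc 0 (G.len e), |u ε e x| ≤ M) ∧ (∀ v, |uV ε v| ≤ M) ∧
      ∀ e, (∫ x in Ioo 0 (G.len e), |u' ε e x| ^ p e) ≤ A + 2 * M * ε := by
  have hbdd : ∀ e, ∃ m, ∀ x ∈ Icc 0 (G.len e), |u 0 e x| ≤ m := fun e =>
    isCompact_Icc.exists_bound_of_continuousOn
      (((hsol 0 le_rfl).2.1.1 e).continuousOn (G.len_pos e))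
  choose m hm using hbdd
  set M₀ := edgeSum G (fun e => |m e|) with hM₀
  have hM₀nn : 0 ≤ M₀ := edgeSum_nonneg fun e => abs_nonneg _
  set M := M₀ + K with hM
  refine ⟨M, edgeSum G (fun e => ∫ x in Ioo 0 (G.len e), |f e x| * M)
    + vertexSum G (fun v => |ωε 0 v| * M), by positivity, fun ε hε hKa hKb => ?_⟩
  have hb : ∀ e, ∀ x ∈ Icc 0 (G.len e), |u ε e x| ≤ M := by
    intro e x hx
    obtain ⟨⟨-, h1⟩, -, h2⟩ := flux_family_sub_le hp (fun e => ⟨(hγ e).1, (hγ e).2.1⟩) hab hflux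
      hsol le_rfl hε
    have h3 := abs_le.1 (((hm e x hx).trans (le_abs_self _)).trans
      (le_edgeSum (F := fun e => |m e|) (fun e => abs_nonneg _) e))
    have h4 := h1 e x hx
    have h5 := h2 e x hx
    rw [abs_le]
    constructor <;> linarith
  have hbV : ∀ v, |uV ε v| ≤ M := by
    intro v
    obtain ⟨e, s, hs⟩ := exists_isEndpoint hab v
    rw [← (hsol ε hε).2.1.apply_endpoint hs]
    exact hb e s hs.mem_Icc
  refine ⟨hb, hbV, fun e => ?_⟩
  have h1 := (hsol ε hε).energy_le hp (fun e => ⟨(hγ e).2.1.monotone, (hγ e).2.2.2⟩) hf hb e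
  have h2 := hflux ε 0 (uV ε)
  simp only [sub_mul, vertexSum_sub] at h2
  have h3 : vertexSum G (fun v => ωε 0 v * uV ε v) ≤ vertexSum G (fun v => |ωε 0 v| * M) :=
    vertexSum_le_vertexSum fun v => (le_abs_self _).trans (by
      rw [abs_mul]
      exact mul_le_mul_of_nonneg_left (hbV v) (abs_nonneg _))
  have h4 : ε * (uV ε a - uV ε b) ≤ ε * (2 * M) :=
    mul_le_mul_of_nonneg_left
      (by linarith [(abs_le.1 (hbV a)).2, (abs_le.1 (hbV b)).1]) hε
  linarith

lemma flux_family_continuousOn (hp : ∀ e, 1 < p e)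
    (hγ : ∀ e, Continuous (γ e) ∧ StrictMono (γ e) ∧ Function.Surjective (γ e) ∧ γ e 0 = 0)
    (hf : ∀ e, IntegrableOn (f e) (Ioo 0 (G.len e)) volume) (hab : a ≠ b)
    (hflux : ∀ ε δ : ℝ, ∀ ψ : G.V → ℝ,
      vertexSum G (fun v => (ωε ε v - ωε δ v) * ψ v) = (ε - δ) * (ψ a - ψ b))
    (hsol : ∀ ε : ℝ, 0 ≤ ε → SolvesGraphProblem G p γ f (ωε ε)
      (fun e x => γ e (u ε e x)) (u ε) (u' ε) (uV ε)) (v : G.V) :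
    ContinuousOn (fun ε => uV ε v) (Ici 0) := by
  obtain ⟨e, s, hs⟩ := exists_isEndpoint hab v
  have hmono := fun {δ ε : ℝ} (hδ : 0 ≤ δ) (hδε : δ ≤ ε) =>
    flux_family_sub_le hp (fun e => ⟨(hγ e).1, (hγ e).2.1⟩) hab hflux hsol hδ hδε
  refine Metric.continuousOn_iff.2 fun t ht η hη => ?_
  have ht0 : 0 ≤ t := ht
  have hT0 : 0 ≤ t + 1 := by linarith
  have hKa := (hmono le_rfl hT0).1.1
  have hKb := (hmono le_rfl hT0).2.1
  obtain ⟨M, A, hM, hbd⟩ := flux_family_bounds hp hγ hf hab hflux hsol (add_nonneg hKa hKb)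
  have hbd' : ∀ ε, 0 ≤ ε → ε ≤ t + 1 →
      (∀ e, ∀ x ∈ Icc 0 (G.len e), |u ε e x| ≤ M) ∧ (∀ v, |uV ε v| ≤ M) ∧
      ∀ e, (∫ x in Ioo 0 (G.len e), |u' ε e x| ^ p e) ≤ A + 2 * M * (t + 1) := by
    intro ε hε hεT
    obtain ⟨h1, h2, h3⟩ := hbd ε hε (by linarith [(hmono hε hεT).1.1])
      (by linarith [(hmono hε hεT).2.1])
    exact ⟨h1, h2, fun e => (h3 e).trans (by gcongr)⟩
  obtain ⟨κ, hκ, hsep⟩ := exists_pos_le_integral_monotone_mul (G.len_pos e) (hp e) (hγ e).1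
    (hγ e).2.1 M (A + 2 * M * (t + 1)) hη hs.mem_Icc
  refine ⟨min 1 (κ / (4 * M + 1)), lt_min one_pos (by positivity), fun ε hε hdist => ?_⟩
  have hε0 : 0 ≤ ε := hε
  rw [Real.dist_eq] at hdist ⊢
  have hεT : ε ≤ t + 1 := by
    linarith [le_abs_self (ε - t), hdist.trans_le (min_le_left _ _)]
  have hκ' : |ε - t| * (4 * M + 1) < κ :=
    (lt_div_iff₀ (by positivity)).1 (hdist.trans_le (min_le_right _ _))
  obtain ⟨hu, huV, huE⟩ := hbd' ε hε0 hεT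
  obtain ⟨hw, hwV, hwE⟩ := hbd' t ht0 (by linarith)
  by_contra! hge
  have hSu := hsol ε hε0
  have hSw := hsol t ht0
  rw [← hSu.2.1.apply_endpoint hs, ← hSw.2.1.apply_endpoint hs] at hge
  have h1 := hsep _ _ _ _ (hSu.2.1.1 e) (hSw.2.1.1 e) (hu e) (hw e) (huE e) (hwE e) hge
  have key := hSu.sub_eq hp hSw (hSu.2.1.sub hp hSw.2.1)
  rw [hflux] at key
  have h2 := le_edgeSum (F := fun e => ∫ x in Ioo 0 (G.len e),
      (γ e (u ε e x) - γ e (u t e x)) * (u ε e x - u t e x))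
    (fun e => integral_nonneg fun x => (hγ e).2.1.monotone.sub_mul_sub_nonneg _ _) e
  have h3 : 0 ≤ edgeSum G (fun e => ∫ x in Ioo 0 (G.len e),
      (rho (p e) (u' ε e x) - rho (p e) (u' t e x)) * (u' ε e x - u' t e x)) :=
    edgeSum_nonneg fun e => integral_nonneg fun x =>
      (rho_monotone (hp e)).sub_mul_sub_nonneg _ _
  have h4 : (ε - t) * (uV ε a - uV t a - (uV ε b - uV t b)) ≤ |ε - t| * (4 * M) := by
    refine (le_abs_self _).trans ?_
    rw [abs_mul]
    refine mul_le_mul_of_nonneg_left (abs_le.2 ?_) (abs_nonneg _)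
    have := abs_le.1 (huV a)
    have := abs_le.1 (hwV a)
    have := abs_le.1 (huV b)
    have := abs_le.1 (hwV b)
    constructor <;> linarith
  linarith [abs_nonneg (ε - t)]

/-- Moving an unbounded amount of flux into a terminal vertex of degree one prevents the values
at `a` and `b` from both staying bounded. -/
lemma flux_family_unbounded (hp : ∀ e, 1 < p e)
    (hγ : ∀ e, Continuous (γ e) ∧ StrictMono (γ e) ∧ Function.Surjective (γ e) ∧ γ e 0 = 0)
    (hf : ∀ e, IntegrableOn (f e) (Ioo 0 (G.len e)) volume) (hab : a ≠ b)
    (hflux : ∀ ε δ : ℝ, ∀ ψ : G.V → ℝ,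
      vertexSum G (fun v => (ωε ε v - ωε δ v) * ψ v) = (ε - δ) * (ψ a - ψ b))
    (hsol : ∀ ε : ℝ, 0 ≤ ε → SolvesGraphProblem G p γ f (ωε ε)
      (fun e x => γ e (u ε e x)) (u ε) (u' ε) (uV ε))
    {e₀ : G.E} (he₀ : G.τ e₀ = a) (hdeg : ∀ e, (G.ι e = a ∨ G.τ e = a) → e = e₀) {c : ℝ}
    (hc : ∀ ε, ωε ε a = c + ε) (K : ℝ) :
    ∃ ε, 0 ≤ ε ∧ (K < uV ε a - uV 0 a ∨ K < uV 0 b - uV ε b) := by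
  subst he₀
  by_contra! hcon
  have hK : 0 ≤ K := by simpa using (hcon 0 le_rfl).1
  obtain ⟨M, A, hM, hbd⟩ := flux_family_bounds hp hγ hf hab hflux hsol hK
  have hℓ := G.len_pos e₀
  obtain ⟨Γ, hΓ⟩ := (isCompact_Icc (a := -M) (b := M)).exists_bound_of_continuousOn
    (hγ e₀).1.continuousOn
  set ℓ := G.len e₀ with hℓdef
  set θ := ℓ / (4 * M + 4) with hθdef
  have hθ : 0 < θ := by positivity
  obtain ⟨C, hC0, hC⟩ := exists_rpow_le_mul_rpow_add (by linarith [hp e₀] : 0 < p e₀ - 1)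
    (by linarith : p e₀ - 1 < p e₀) hθ
  set F := ∫ x in Ioo 0 ℓ, |f e₀ x|
  set B := Γ * ℓ + F + ℓ⁻¹ * (θ * A + C * ℓ) - c with hB
  have bound : ∀ ε, 0 ≤ ε → ε ≤ 2 * B := by
    intro ε hε
    obtain ⟨h1, -, h3⟩ := hbd ε hε (hcon ε hε).1 (hcon ε hε).2
    have h4 := (hsol ε hε).flux_le hp hf hdeg (Γ := Γ)
      (fun x hx => hΓ _ (abs_le.1 (h1 e₀ x hx))) hC
    rw [hc, ← hℓdef] at h4
    have h5 : ℓ⁻¹ * (θ * (∫ x in Ioo 0 ℓ, |u' ε e₀ x| ^ p e₀) + C * ℓ)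
        ≤ ℓ⁻¹ * (θ * (A + 2 * M * ε) + C * ℓ) := by
      have := h3 e₀
      gcongr
    have h6 : ℓ⁻¹ * (θ * (A + 2 * M * ε) + C * ℓ)
        = ℓ⁻¹ * (θ * A + C * ℓ) + M / (2 * M + 2) * ε := by
      rw [hθdef]
      field_simp
      ring
    have h7 : M / (2 * M + 2) ≤ 1 / 2 := by
      rw [div_le_div_iff₀ (by positivity) (by positivity)]
      linarith
    have h8 := mul_le_mul_of_nonneg_right h7 hε
    linarith
  have := bound (2 * |B| + 1) (by positivity)
  linarith [le_abs_self B]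

end FluxFamily

/-- Lemma 3.7: flux transferred from a degree-1 vertex v₁ to a degree-1
vertex vₙ. The vertex values depend continuously and monotonically on ε ≥ 0, and as
ε → +∞ either u_ε(vₙ) → +∞ or u_ε(v₁) → −∞. -/
theorem graph_boundary_flux_transfer
    (G : MetricGraph) (p : G.E → ℝ) (hp : ∀ e, 1 < p e)
    (γ : G.E → ℝ → ℝ)
    (hγ : ∀ e, Continuous (γ e) ∧ StrictMono (γ e) ∧ Function.Surjective (γ e) ∧ γ e 0 = 0)
    (f : G.E → ℝ → ℝ) (hf : ∀ e, IntegrableOn (f e) (Ioo 0 (G.len e)) volume)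
    (ω : G.V → ℝ)
    (hcard : 3 ≤ vertexCard G)
    (v₁ vₙ : G.V) (hne : v₁ ≠ vₙ)
    (e₁ e₂ : G.E) (hee : e₁ ≠ e₂)
    (hι₁ : G.ι e₁ = v₁) (hτ₂ : G.τ e₂ = vₙ)
    (hdeg₁ : ∀ e, (G.ι e = v₁ ∨ G.τ e = v₁) → e = e₁)
    (hdegₙ : ∀ e, (G.ι e = vₙ ∨ G.τ e = vₙ) → e = e₂)
    (ωε : ℝ → G.V → ℝ)
    (hωε : ∀ ε : ℝ, ωε ε v₁ = ω v₁ - ε ∧ ωε ε vₙ = ω vₙ + ε ∧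
      ∀ w : G.V, w ≠ v₁ → w ≠ vₙ → ωε ε w = ω w)
    (u u' : ℝ → G.E → ℝ → ℝ) (uV : ℝ → G.V → ℝ)
    (hsol : ∀ ε : ℝ, 0 ≤ ε → SolvesGraphProblem G p γ f (ωε ε)
      (fun e x => γ e (u ε e x)) (u ε) (u' ε) (uV ε)) :
    ContinuousOn (fun ε => uV ε vₙ) (Ici 0) ∧
    MonotoneOn (fun ε => uV ε vₙ) (Ici 0) ∧
    ContinuousOn (fun ε => uV ε v₁) (Ici 0) ∧
    AntitoneOn (fun ε => uV ε v₁) (Ici 0) ∧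
    (Tendsto (fun ε => uV ε vₙ) atTop atTop ∨
     Tendsto (fun ε => uV ε v₁) atTop atBot) := by
  have hab : vₙ ≠ v₁ := hne.symm
  have hflux : ∀ ε δ : ℝ, ∀ ψ : G.V → ℝ,
      vertexSum G (fun v => (ωε ε v - ωε δ v) * ψ v) = (ε - δ) * (ψ vₙ - ψ v₁) := by
    intro ε δ
    refine vertexSum_transfer hab ?_ ?_ fun v hvn hv1 => ?_
    · rw [(hωε ε).2.1, (hωε δ).2.1]
      ring
    · rw [(hωε ε).1, (hωε δ).1]
      ring
    · rw [(hωε ε).2.2 v hv1 hvn, (hωε δ).2.2 v hv1 hvn, sub_self]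
  have hmono : MonotoneOn (fun ε => uV ε vₙ) (Ici 0) := fun δ hδ ε _ hδε =>
    sub_nonneg.1 (flux_family_sub_le hp (fun e => ⟨(hγ e).1, (hγ e).2.1⟩) hab hflux hsol
      hδ hδε).1.1
  have hanti : AntitoneOn (fun ε => uV ε v₁) (Ici 0) := fun δ hδ ε _ hδε =>
    sub_nonneg.1 (flux_family_sub_le hp (fun e => ⟨(hγ e).1, (hγ e).2.1⟩) hab hflux hsol
      hδ hδε).2.1
  refine ⟨flux_family_continuousOn hp hγ hf hab hflux hsol vₙ, hmono,
    flux_family_continuousOn hp hγ hf hab hflux hsol v₁, hanti, ?_⟩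
  have hunb := flux_family_unbounded hp hγ hf hab hflux hsol hτ₂ hdegₙ (fun ε => (hωε ε).2.1)
  by_cases hn : ∃ B, ∀ ε, 0 ≤ ε → uV ε vₙ ≤ B
  · obtain ⟨B, hB⟩ := hn
    right
    refine tendsto_atBot.2 fun c => ?_
    obtain ⟨ε, hε, h | h⟩ := hunb (max (B - uV 0 vₙ) (uV 0 v₁ - c))
    · linarith [hB ε hε, le_max_left (B - uV 0 vₙ) (uV 0 v₁ - c)]
    · filter_upwards [eventually_ge_atTop ε] with t ht
      have := hanti hε (hε.trans ht : 0 ≤ t) ht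
      simp only at this
      linarith [le_max_right (B - uV 0 vₙ) (uV 0 v₁ - c)]
  · push Not at hn
    left
    refine tendsto_atTop.2 fun c => ?_
    obtain ⟨ε, hε, h⟩ := hn c
    filter_upwards [eventually_ge_atTop ε] with t ht
    exact h.le.trans (hmono hε (hε.trans ht : 0 ≤ t) ht)
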